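/- Let 1 ≤ k ≤ n−1 and let f : Λ^{k+1} × Λ^{k−1} → ℝ. Then f is ext-int. polyaffine if and only if f is ext-int. one affine. -/

import Mathlib

/-! Basic setup: `Λᵏ(ℝⁿ)` in coordinates with respect to the standard basis
`e^I`, `I` a strictly increasing multi-index (modeled as a `k`-element subset of
`Fin n`), together with the exterior product, interior product, inner product,
Hodge star, and the various notions of one-directional convexity/affinity. -/

/-- Increasing multi-indices of length `k` in `{1,…,n}`: `k`-element subsets of `Fin n`.
`Idx n k` plays the role of `T_k`. -/
abbrev Idx (n k : ℕ) := {s : Finset (Fin n) // s.card = k}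

/-- `Λᵏ(ℝⁿ)`, identified with its coordinates in the standard basis `e^I`. -/
abbrev Lam (n k : ℕ) := Idx n k → ℝ

/-- The sign `sgn(R,S)` defined by `e^{[R,S]} = sgn(R,S) e^R ∧ e^S` for disjoint
increasing multi-indices: `(-1)` to the number of inversions between `R` and `S`. -/
def msign {n : ℕ} (R S : Finset (Fin n)) : ℝ :=
  (-1 : ℝ) ^ (((R ×ˢ S).filter (fun p => p.2 < p.1)).card)

/-- The basis form `e^S` (of degree `k = S.card`; zero if `k ≠ S.card`). -/
def bform {n k : ℕ} (S : Finset (Fin n)) : Lam n k :=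
  fun I => if I.1 = S then 1 else 0

/-- Exterior (wedge) product in coordinates.  When `m = k + l` this is the wedge
product `Λᵏ × Λˡ → Λ^{k+l}`; for other `m` it is `0`. -/
def wedge {n k l m : ℕ} (ω : Lam n k) (φ : Lam n l) : Lam n m :=
  fun I => ∑ R : Idx n k, ∑ S : Idx n l,
    if R.1 ∪ S.1 = I.1 ∧ Disjoint R.1 S.1 then msign R.1 S.1 * (ω R * φ S) else 0

/-- Interior product `a ⌟ b`, characterized by `⟨a ⌟ b; c⟩ = ⟨b; a ∧ c⟩`.  When
`m = k - j` this is the interior product `Λʲ × Λᵏ → Λ^{k-j}`; for other `m` it is `0`. -/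
def iprod {n j k m : ℕ} (a : Lam n j) (b : Lam n k) : Lam n m :=
  fun C => ∑ A : Idx n j, ∑ B : Idx n k,
    if A.1 ∪ C.1 = B.1 ∧ Disjoint A.1 C.1 then msign A.1 C.1 * (a A * b B) else 0

/-- Hodge star with respect to the standard orientation; when `m = n - k` this is
`∗ : Λᵏ → Λ^{n-k}`. -/
def hstar {n k m : ℕ} (ω : Lam n k) : Lam n m :=
  fun J => ∑ I : Idx n k, if I.1 = (J.1)ᶜ then msign I.1 J.1 * ω I else 0

/-- Inner product `⟨·;·⟩` on `Λᵏ` (the basis `e^I` is orthonormal). -/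
def ip {n k : ℕ} (ω α : Lam n k) : ℝ := ∑ I : Idx n k, ω I * α I

/-- `s`-fold exterior power `ω^s = ω ∧ ⋯ ∧ ω` (with `ω^0 = 1 ∈ Λ⁰`). -/
def lpow {n k : ℕ} (ω : Lam n k) : (s : ℕ) → Lam n (k * s)
  | 0 => bform ∅
  | s + 1 => wedge ω (lpow ω s)

/-- `f : Λᵏ → ℝ` is ext. one convex. -/
def ExtOneConvex {n k : ℕ} (f : Lam n k → ℝ) : Prop :=
  ∀ (ω : Lam n k) (a : Lam n 1) (b : Lam n (k-1)),
    ConvexOn ℝ Set.univ (fun t : ℝ => f (ω + t • (wedge a b : Lam n k)))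

/-- `f : Λᵏ → ℝ` is ext. one affine. -/
def ExtOneAffine {n k : ℕ} (f : Lam n k → ℝ) : Prop :=
  ExtOneConvex f ∧ ExtOneConvex (fun ω => -f ω)

/-- `f : Λᵏ → ℝ` is int. one convex. -/
def IntOneConvex {n k : ℕ} (f : Lam n k → ℝ) : Prop :=
  ∀ (ω : Lam n k) (a : Lam n 1) (b : Lam n (k+1)),
    ConvexOn ℝ Set.univ (fun t : ℝ => f (ω + t • (iprod a b : Lam n k)))

/-- `f : Λᵏ → ℝ` is int. one affine. -/
def IntOneAffine {n k : ℕ} (f : Lam n k → ℝ) : Prop :=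
  IntOneConvex f ∧ IntOneConvex (fun ω => -f ω)

/-- `f : Λ^{k+1} × Λ^{k-1} → ℝ` is ext-int. one convex. -/
def ExtIntOneConvex {n k : ℕ} (f : Lam n (k+1) → Lam n (k-1) → ℝ) : Prop :=
  ∀ (ξ : Lam n (k+1)) (η : Lam n (k-1)) (a : Lam n 1) (b : Lam n k),
    ConvexOn ℝ Set.univ
      (fun t : ℝ => f (ξ + t • (wedge a b : Lam n (k+1))) (η + t • (iprod a b : Lam n (k-1))))

/-- `f : Λ^{k+1} × Λ^{k-1} → ℝ` is ext-int. one affine. -/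
def ExtIntOneAffine {n k : ℕ} (f : Lam n (k+1) → Lam n (k-1) → ℝ) : Prop :=
  ExtIntOneConvex f ∧ ExtIntOneConvex (fun ξ η => -f ξ η)

/-- `g : Λᵏ → ℝ` is affine, i.e. a constant plus a linear functional. -/
def AffineFn {n k : ℕ} (g : Lam n k → ℝ) : Prop :=
  ∃ (c : ℝ) (a : Lam n k), ∀ ω, g ω = c + ip a ω

/-- `f : Λ^{k+1} × Λ^{k-1} → ℝ` is ext-int. polyconvex: there is a convex function
`F : Λ^{k+1} × ⋯ × Λ^{(k+1)⌊n/(k+1)⌋} × Λ^{n-k+1} × ⋯ × Λ^{(n-k+1)⌊n/(n-k+1)⌋} → ℝ`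
with `f(ξ,η) = F(ξ, …, ξ^{⌊n/(k+1)⌋}, ∗η, …, (∗η)^{⌊n/(n-k+1)⌋})`. -/
def ExtIntPolyconvex {n k : ℕ} (f : Lam n (k+1) → Lam n (k-1) → ℝ) : Prop :=
  ∃ F : ((s : Fin (n / (k+1))) → Lam n ((k+1) * (s.1+1)))
        × ((r : Fin (n / (n-k+1))) → Lam n ((n-k+1) * (r.1+1))) → ℝ,
    ConvexOn ℝ Set.univ F ∧
      ∀ (ξ : Lam n (k+1)) (η : Lam n (k-1)),
        f ξ η = F ⟨fun s => lpow ξ (s.1+1), fun r => lpow (hstar η : Lam n (n-k+1)) (r.1+1)⟩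

/-- `f` is ext-int. polyaffine. -/
def ExtIntPolyaffine {n k : ℕ} (f : Lam n (k+1) → Lam n (k-1) → ℝ) : Prop :=
  ExtIntPolyconvex f ∧ ExtIntPolyconvex (fun ξ η => -f ξ η)

open Finset

/-- The exterior algebra of `ℝⁿ`. -/
abbrev ExtAlg (n : ℕ) := ExteriorAlgebra ℝ (Fin n → ℝ)

/-- The basis `e^S` of the exterior algebra, indexed by all `S ⊆ {1,…,n}`. -/
noncomputable def extBasis (n : ℕ) : Module.Basis (Finset (Fin n)) ℝ (ExtAlg n) :=
  (Pi.basisFun ℝ (Fin n)).ExteriorAlgebra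

/-- The degree-one generator `e^i` of the exterior algebra. -/
noncomputable def extGen {n : ℕ} (i : Fin n) : ExtAlg n := ExteriorAlgebra.ι ℝ (Pi.single i 1)

theorem extBasis_eq_prod {n : ℕ} (S : Finset (Fin n)) :
    extBasis n S = ((S.sort (· ≤ ·)).map extGen).prod := by
  rw [extBasis, ExteriorAlgebra.basis_apply]
  simp only [ExteriorAlgebra.ιMulti_family, ExteriorAlgebra.ιMulti_apply]
  congr 1
  apply List.ext_getElem
  · simp
  · intro i h1 h2
    simp [extGen, Set.powersetCard.ofFinEmbEquiv_symm_apply, Finset.orderEmbOfFin_apply]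

theorem extBasis_empty (n : ℕ) : extBasis n ∅ = 1 := by
  simp [extBasis_eq_prod]

theorem extBasis_insert {n : ℕ} {m : Fin n} {S : Finset (Fin n)} (h : ∀ x ∈ S, m < x) :
    extBasis n (insert m S) = extGen m * extBasis n S := by
  rw [extBasis_eq_prod, Finset.sort_insert _ (fun b hb => (h b hb).le)
    (fun hm => lt_irrefl _ (h m hm)), List.map_cons, List.prod_cons, ← extBasis_eq_prod]

theorem extBasis_singleton {n : ℕ} (i : Fin n) : extBasis n {i} = extGen i := by
  simp [extBasis_eq_prod]

theorem msign_eq_prod {n : ℕ} (R S : Finset (Fin n)) :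
    msign R S = ∏ r ∈ R, ∏ s ∈ S, if s < r then (-1 : ℝ) else 1 := by
  rw [msign, ← Finset.prod_product', ← Finset.prod_filter, Finset.prod_const]

theorem msign_union_left {n : ℕ} {R R' : Finset (Fin n)} (S : Finset (Fin n))
    (h : Disjoint R R') : msign (R ∪ R') S = msign R S * msign R' S := by
  simp only [msign_eq_prod, Finset.prod_union h]

theorem msign_union_right {n : ℕ} (R : Finset (Fin n)) {S S' : Finset (Fin n)}
    (h : Disjoint S S') : msign R (S ∪ S') = msign R S * msign R S' := by
  simp only [msign_eq_prod, Finset.prod_union h, Finset.prod_mul_distrib]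

theorem msign_mul_self {n : ℕ} (R S : Finset (Fin n)) : msign R S * msign R S = 1 := by
  rw [msign, ← pow_add]; exact Even.neg_one_pow ⟨_, rfl⟩

theorem msign_mul_swap {n : ℕ} {R S : Finset (Fin n)} (h : Disjoint R S) :
    msign R S * msign S R = (-1) ^ (R.card * S.card) := by
  rw [msign_eq_prod, msign_eq_prod, Finset.prod_comm (s := S), ← Finset.prod_mul_distrib]
  simp only [← Finset.prod_mul_distrib]
  rw [Finset.prod_congr rfl (g := fun _ => (-1 : ℝ) ^ S.card)]
  · rw [Finset.prod_const, ← pow_mul, mul_comm]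
  · intro r hr
    rw [Finset.prod_congr rfl (g := fun _ => (-1 : ℝ))]
    · simp
    · intro s hs
      have : r ≠ s := fun e => Finset.disjoint_left.1 h hr (e ▸ hs)
      rcases this.lt_or_gt with h | h <;> simp [h, h.not_gt]

theorem msign_singleton_of_lt {n : ℕ} {m : Fin n} {S : Finset (Fin n)} (h : ∀ x ∈ S, m < x) :
    msign {m} S = 1 := by
  rw [msign_eq_prod, Finset.prod_singleton]
  exact Finset.prod_eq_one fun s hs => by simp [(h s hs).not_gt]

theorem extGen_mul_self {n : ℕ} (i : Fin n) : extGen i * extGen i = 0 :=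
  ExteriorAlgebra.ι_sq_zero _

theorem extGen_mul_swap {n : ℕ} (i j : Fin n) : extGen i * extGen j = -(extGen j * extGen i) :=
  eq_neg_of_add_eq_zero_left (ExteriorAlgebra.ι_add_mul_swap _ _)

theorem extGen_mul_extBasis {n : ℕ} (i : Fin n) (S : Finset (Fin n)) :
    extGen i * extBasis n S = if i ∈ S then 0 else msign {i} S • extBasis n (insert i S) := by
  induction S using Finset.induction_on_min with
  | empty => simp [extBasis_empty, msign, extBasis_singleton]
  | insert m S hm ih =>
    have hmS : m ∉ S := fun h => lt_irrefl _ (hm m h)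
    rw [extBasis_insert hm]
    rcases lt_trichotomy i m with h | rfl | h
    · have h2 : ∀ x ∈ insert m S, i < x := by
        intro x hx
        rcases Finset.mem_insert.1 hx with rfl | hx
        exacts [h, h.trans (hm x hx)]
      have h3 : i ∉ insert m S := fun h => lt_irrefl _ (h2 i h)
      rw [if_neg h3, extBasis_insert h2, msign_singleton_of_lt h2, one_smul, extBasis_insert hm]
    · rw [← mul_assoc, extGen_mul_self]; simp
    · rw [← mul_assoc, extGen_mul_swap, neg_mul, mul_assoc, ih]
      by_cases hi : i ∈ S
      · simp [hi]
      · have hi' : i ∉ insert m S := by simp [hi, h.ne']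
        rw [if_neg hi, if_neg hi', Finset.insert_comm, extBasis_insert (m := m)]
        · rw [Finset.insert_eq m S, msign_union_right _ (by simpa using hmS)]
          simp [msign_eq_prod, h]
        · intro x hx
          rcases Finset.mem_insert.1 hx with rfl | hx
          exacts [h, hm x hx]

theorem extBasis_mul {n : ℕ} (R S : Finset (Fin n)) :
    extBasis n R * extBasis n S =
      if Disjoint R S then msign R S • extBasis n (R ∪ S) else 0 := by
  induction R using Finset.induction_on_min with
  | empty => simp [extBasis_empty, msign]
  | insert m R hm ih =>
    have hmR : m ∉ R := fun h => lt_irrefl _ (hm m h)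
    rw [extBasis_insert hm, mul_assoc, ih]
    by_cases hd : Disjoint R S
    · rw [if_pos hd, mul_smul_comm, extGen_mul_extBasis]
      by_cases hS : m ∈ S
      · simp [hS]
      · have : m ∉ R ∪ S := by simp [hmR, hS]
        rw [if_neg this, if_pos (by simp [hS, hd]), Finset.insert_union, smul_smul,
          msign_union_right _ hd, msign_singleton_of_lt hm, one_mul, Finset.insert_eq m R,
          msign_union_left _ (by simpa using hmR), mul_comm]
    · simp [hd]

/-- Contraction by the covector `v ↦ ⟨a; v⟩`. -/
noncomputable def contr {n : ℕ} (a : Fin n → ℝ) : ExtAlg n →ₗ[ℝ] ExtAlg n :=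
  CliffordAlgebra.contractLeft (Q := (0 : QuadraticForm ℝ (Fin n → ℝ)))
    (Fintype.linearCombination ℝ a)

theorem contr_ι_mul {n : ℕ} (a v : Fin n → ℝ) (z : ExtAlg n) :
    contr a (ExteriorAlgebra.ι ℝ v * z) =
      (∑ i, v i * a i) • z - ExteriorAlgebra.ι ℝ v * contr a z := by
  have := CliffordAlgebra.contractLeft_ι_mul (Q := (0 : QuadraticForm ℝ (Fin n → ℝ)))
    (d := Fintype.linearCombination ℝ a) v z
  simpa [contr, Fintype.linearCombination_apply] using this

theorem contr_add {n : ℕ} (a b : Fin n → ℝ) (z : ExtAlg n) :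
    contr (a + b) z = contr a z + contr b z := by
  have : Fintype.linearCombination ℝ (a + b) =
    Fintype.linearCombination ℝ a + Fintype.linearCombination ℝ b := by
    ext; simp [Fintype.linearCombination_apply, Pi.single_apply]
  rw [contr, this, map_add]; rfl

theorem contr_smul {n : ℕ} (c : ℝ) (a : Fin n → ℝ) (z : ExtAlg n) :
    contr (c • a) z = c • contr a z := by
  have : Fintype.linearCombination ℝ (c • a) = c • Fintype.linearCombination ℝ a := by
    ext; simp [Fintype.linearCombination_apply, Pi.single_apply]
  rw [contr, this, map_smul]; rfl

theorem contr_single_extBasis_of_notMem {n : ℕ} {i : Fin n} {S : Finset (Fin n)} (h : i ∉ S) :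
    contr (Pi.single i 1) (extBasis n S) = 0 := by
  induction S using Finset.induction_on_min with
  | empty => rw [extBasis_empty]; exact CliffordAlgebra.contractLeft_one _ _
  | insert m S hm ih =>
    simp only [Finset.mem_insert, not_or] at h
    rw [extBasis_insert hm, extGen, contr_ι_mul, ih h.2]
    simp [Pi.single_apply, h.1]

theorem contr_single_extBasis_insert {n : ℕ} {i : Fin n} {S : Finset (Fin n)} (h : i ∉ S) :
    contr (Pi.single i 1) (extBasis n (insert i S)) = msign {i} S • extBasis n S := by
  have h1 := extGen_mul_extBasis i S
  rw [if_neg h] at h1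
  have h2 : extBasis n (insert i S) = msign {i} S • (extGen i * extBasis n S) := by
    rw [h1, smul_smul, msign_mul_self, one_smul]
  rw [h2, map_smul, extGen, contr_ι_mul, contr_single_extBasis_of_notMem h]
  simp [Pi.single_apply]

/-- The inclusion `Λᵏ ↪ Λ` of `k`-forms into the exterior algebra. -/
noncomputable def toExt {n k : ℕ} : Lam n k →ₗ[ℝ] ExtAlg n :=
  Fintype.linearCombination ℝ (fun I : Idx n k => extBasis n I.1)

theorem toExt_apply {n k : ℕ} (ω : Lam n k) : toExt ω = ∑ I, ω I • extBasis n I.1 := rfl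

theorem toExt_injective {n k : ℕ} : Function.Injective (toExt : Lam n k → ExtAlg n) :=
  ((extBasis n).linearIndependent.comp (fun I : Idx n k => I.1)
    Subtype.val_injective).fintypeLinearCombination_injective

theorem toExt_single {n k : ℕ} (I : Idx n k) (c : ℝ) :
    toExt (Pi.single I c) = c • extBasis n I.1 := by
  simp [toExt]

theorem toExt_bform_empty {n : ℕ} : toExt (bform ∅ : Lam n 0) = 1 := by
  have : (bform ∅ : Lam n 0) = Pi.single ⟨∅, rfl⟩ 1 := by
    ext I
    simp [bform, Pi.single_apply, Subtype.ext_iff]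
  rw [this, toExt_single, extBasis_empty, one_smul]

theorem toExt_wedge {n k l m : ℕ} (h : m = k + l) (ω : Lam n k) (φ : Lam n l) :
    toExt (wedge ω φ : Lam n m) = toExt ω * toExt φ := by
  simp only [toExt_apply, wedge, Finset.sum_mul_sum, Finset.sum_smul]
  rw [Finset.sum_comm]
  refine Finset.sum_congr rfl fun R _ => ?_
  rw [Finset.sum_comm]
  refine Finset.sum_congr rfl fun S _ => ?_
  rw [smul_mul_smul_comm, extBasis_mul]
  by_cases hd : Disjoint R.1 S.1
  · have hc : (R.1 ∪ S.1).card = m := by rw [Finset.card_union_of_disjoint hd, R.2, S.2, h]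
    rw [Finset.sum_eq_single (⟨R.1 ∪ S.1, hc⟩ : Idx n m)]
    · simp [hd, smul_smul, mul_comm]
    · intro I _ hI
      rw [if_neg, zero_smul]
      rintro ⟨h1, -⟩
      exact hI (Subtype.ext h1.symm)
    · simp
  · simp [hd]

/-- The vector underlying a one-form. -/
def vec {n : ℕ} (a : Lam n 1) : Fin n → ℝ := fun i => a ⟨{i}, Finset.card_singleton i⟩

/-- The one-form with given coefficients. -/
def ofVec {n : ℕ} (v : Fin n → ℝ) : Lam n 1 := fun I => ∑ i ∈ I.1, v i

theorem vec_ofVec {n : ℕ} (v : Fin n → ℝ) : vec (ofVec v) = v := by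
  ext i; simp [vec, ofVec]

/-- The indices of degree one are the singletons. -/
noncomputable def idxOneEquiv (n : ℕ) : Fin n ≃ Idx n 1 :=
  Equiv.ofBijective (fun i => ⟨{i}, Finset.card_singleton i⟩)
    ⟨fun i j h => by simpa using h, fun I => by
      obtain ⟨i, hi⟩ := Finset.card_eq_one.1 I.2
      exact ⟨i, Subtype.ext hi.symm⟩⟩

theorem idxOneEquiv_coe {n : ℕ} (i : Fin n) : (idxOneEquiv n i).1 = {i} := rfl

theorem apply_idxOneEquiv {n : ℕ} (a : Lam n 1) (i : Fin n) : a (idxOneEquiv n i) = vec a i := rfl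

theorem vec_eq_sum {n : ℕ} (a : Lam n 1) : vec a = ∑ i, vec a i • Pi.single i (1 : ℝ) := by
  ext j; simp [Pi.single_apply]

theorem toExt_one {n : ℕ} (a : Lam n 1) : toExt a = ExteriorAlgebra.ι ℝ (vec a) := by
  conv_rhs => rw [vec_eq_sum, map_sum]
  rw [toExt_apply, ← (idxOneEquiv n).sum_comp]
  refine Finset.sum_congr rfl fun i _ => ?_
  rw [apply_idxOneEquiv a i, idxOneEquiv_coe, extBasis_singleton, map_smul]
  rfl

theorem iprod_one_apply {n k m : ℕ} (a : Lam n 1) (b : Lam n k) (C : Idx n m) :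
    (iprod a b : Lam n m) C = ∑ i : Fin n, ∑ B : Idx n k,
      if insert i C.1 = B.1 ∧ i ∉ C.1 then msign {i} C.1 * (vec a i * b B) else 0 := by
  rw [iprod, ← (idxOneEquiv n).sum_comp]
  refine Finset.sum_congr rfl fun i _ => Finset.sum_congr rfl fun B _ => if_congr ?_ rfl rfl
  rw [idxOneEquiv_coe, Finset.insert_eq, Finset.disjoint_singleton_left]

theorem contr_eq_sum {n : ℕ} (v : Fin n → ℝ) (z : ExtAlg n) :
    contr v z = ∑ i : Fin n, v i • contr (Pi.single i 1) z := by
  let L : (Fin n → ℝ) →ₗ[ℝ] ExtAlg n :=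
    { toFun := fun v => contr v z
      map_add' := fun v w => contr_add v w z
      map_smul' := fun c v => contr_smul c v z }
  change L v = ∑ i : Fin n, v i • L (Pi.single i 1)
  conv_lhs => rw [pi_eq_sum_univ' v]
  simp only [map_sum, map_smul]

theorem toExt_iprod {n k m : ℕ} (h : k = m + 1) (a : Lam n 1) (b : Lam n k) :
    toExt (iprod a b : Lam n m) = contr (vec a) (toExt b) := by
  rw [contr_eq_sum]
  simp only [toExt_apply, iprod_one_apply, map_sum, map_smul, Finset.sum_smul, Finset.smul_sum]
  rw [Finset.sum_comm]
  refine Finset.sum_congr rfl fun i _ => ?_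
  rw [Finset.sum_comm]
  refine Finset.sum_congr rfl fun B _ => ?_
  by_cases hi : i ∈ B.1
  · have hc : (B.1.erase i).card = m := by rw [Finset.card_erase_of_mem hi, B.2, h]; rfl
    rw [Finset.sum_eq_single (⟨B.1.erase i, hc⟩ : Idx n m)]
    · have : B.1 = insert i (B.1.erase i) := (Finset.insert_erase hi).symm
      conv_rhs => rw [this]
      rw [contr_single_extBasis_insert (Finset.notMem_erase i _), if_pos]
      · simp only [smul_smul]; congr 1; ring
      · simp [hi]
    · intro C _ hC
      rw [if_neg, zero_smul]
      rintro ⟨h1, h2⟩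
      refine hC (Subtype.ext ?_)
      simp only [← h1]
      rw [Finset.erase_insert (by simpa using h2)]
    · simp
  · rw [contr_single_extBasis_of_notMem hi, smul_zero, smul_zero]
    refine Finset.sum_eq_zero fun C _ => ?_
    rw [if_neg, zero_smul]
    rintro ⟨h1, -⟩
    exact hi (h1 ▸ by simp)

theorem ι_eq_sum {n : ℕ} (v : Fin n → ℝ) :
    ExteriorAlgebra.ι ℝ v = ∑ i : Fin n, v i • extGen i := by
  conv_lhs => rw [pi_eq_sum_univ' v]
  simp only [map_sum, map_smul]
  rfl

theorem contr_contr {n : ℕ} (v : Fin n → ℝ) (z : ExtAlg n) : contr v (contr v z) = 0 :=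
  CliffordAlgebra.contractLeft_contractLeft _ _

theorem toExt_lpow {n k : ℕ} (ω : Lam n k) (s : ℕ) : toExt (lpow ω s) = toExt ω ^ s := by
  induction s with
  | zero => rw [pow_zero]; exact toExt_bform_empty
  | succ s ih => rw [lpow, toExt_wedge (by ring), ih, pow_succ']

theorem ι_mul_mul_ι {n : ℕ} (v : Fin n → ℝ) (z : ExtAlg n) :
    ExteriorAlgebra.ι ℝ v * z * ExteriorAlgebra.ι ℝ v = 0 := by
  suffices ∃ z', z * ExteriorAlgebra.ι ℝ v = ExteriorAlgebra.ι ℝ v * z' by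
    obtain ⟨z', hz⟩ := this
    rw [mul_assoc, hz, ← mul_assoc, ExteriorAlgebra.ι_sq_zero, zero_mul]
  induction z using ExteriorAlgebra.induction with
  | algebraMap r => exact ⟨algebraMap _ _ r, Algebra.commutes _ _⟩
  | ι x =>
    exact ⟨-ExteriorAlgebra.ι ℝ x, by
      rw [mul_neg, eq_neg_iff_add_eq_zero, ExteriorAlgebra.ι_add_mul_swap]⟩
  | mul x y hx hy =>
    obtain ⟨x', hx⟩ := hx
    obtain ⟨y', hy⟩ := hy
    exact ⟨x' * y', by rw [mul_assoc, hy, ← mul_assoc, hx, mul_assoc]⟩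
  | add x y hx hy =>
    obtain ⟨x', hx⟩ := hx
    obtain ⟨y', hy⟩ := hy
    exact ⟨x' + y', by rw [add_mul, hx, hy, mul_add]⟩

theorem exists_add_smul_pow {A : Type*} [Ring A] [Algebra ℝ A] (X Y : A)
    (h : ∀ z, Y * z * Y = 0) (s : ℕ) :
    ∃ Z, (∀ z, Y * z * Z = 0) ∧ ∀ t : ℝ, (X + t • Y) ^ s = X ^ s + t • Z := by
  induction s with
  | zero => exact ⟨0, by simp, by simp⟩
  | succ s ih =>
    obtain ⟨Z, hZ, hs⟩ := ih
    refine ⟨X * Z + Y * X ^ s, fun z => ?_, fun t => ?_⟩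
    · rw [mul_add, ← mul_assoc, ← mul_assoc, h, zero_mul, add_zero, mul_assoc Y, hZ]
    · have h1 : Y * Z = 0 := by simpa using hZ 1
      rw [pow_succ', hs, pow_succ', add_mul, mul_add, mul_add, smul_mul_assoc, smul_mul_assoc,
        mul_smul_comm, mul_smul_comm, h1]
      simp only [smul_zero, add_zero, smul_add, add_assoc]

theorem lpow_add_smul_wedge {n k m : ℕ} (h : k = 1 + m) (ω : Lam n k) (a : Lam n 1) (b : Lam n m)
    (s : ℕ) (t : ℝ) :
    lpow (ω + t • (wedge a b : Lam n k)) s =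
      t • (lpow (ω + (wedge a b : Lam n k)) s - lpow ω s) + lpow ω s := by
  have hY : ∀ z, toExt (wedge a b : Lam n k) * z * toExt (wedge a b : Lam n k) = 0 := by
    intro z
    rw [toExt_wedge h, toExt_one]
    calc _ = (ExteriorAlgebra.ι ℝ (vec a) * (toExt b * z) * ExteriorAlgebra.ι ℝ (vec a))
          * toExt b := by simp only [mul_assoc]
      _ = 0 := by rw [ι_mul_mul_ι, zero_mul]
  obtain ⟨Z, -, hZ⟩ := exists_add_smul_pow (toExt ω) _ hY s
  apply toExt_injective
  have h1 := hZ 1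
  rw [one_smul, one_smul] at h1
  simp only [toExt_lpow, map_add, map_sub, map_smul, hZ, h1]
  rw [add_sub_cancel_left, add_comm]

/-- The Hodge star operator on the whole exterior algebra. -/
noncomputable def starExt (n : ℕ) : ExtAlg n →ₗ[ℝ] ExtAlg n :=
  (extBasis n).constr ℝ fun S => msign S Sᶜ • extBasis n Sᶜ

theorem starExt_extBasis {n : ℕ} (S : Finset (Fin n)) :
    starExt n (extBasis n S) = msign S Sᶜ • extBasis n Sᶜ :=
  (extBasis n).constr_basis ℝ _ _

theorem toExt_hstar {n k m : ℕ} (h : k + m = n) (ω : Lam n k) :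
    toExt (hstar ω : Lam n m) = starExt n (toExt ω) := by
  simp only [toExt_apply, hstar, map_sum, map_smul, starExt_extBasis, Finset.sum_smul]
  rw [Finset.sum_comm]
  refine Finset.sum_congr rfl fun I _ => ?_
  have hc : (I.1ᶜ).card = m := by rw [Finset.card_compl, I.2, Fintype.card_fin]; omega
  rw [Finset.sum_eq_single (⟨I.1ᶜ, hc⟩ : Idx n m)]
  · simp only [compl_compl, if_true, smul_smul, mul_comm]
  · intro J _ hJ
    rw [if_neg, zero_smul]
    intro e
    exact hJ (Subtype.ext (by simp [e]))
  · simp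

theorem hstar_hstar {n k m : ℕ} (h : k + m = n) (ω : Lam n k) :
    (hstar (hstar ω : Lam n m) : Lam n k) = (-1 : ℝ) ^ (k * m) • ω := by
  apply toExt_injective
  rw [toExt_hstar (by omega), toExt_hstar h, map_smul, toExt_apply]
  simp only [map_sum, map_smul, starExt_extBasis, compl_compl, Finset.smul_sum]
  refine Finset.sum_congr rfl fun I _ => ?_
  have hc : (I.1ᶜ).card = m := by rw [Finset.card_compl, I.2, Fintype.card_fin]; omega
  have := msign_mul_swap (disjoint_compl_right (a := I.1))
  rw [I.2, hc] at this
  rw [smul_smul (msign _ _), this, smul_comm]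

theorem starExt_contr {n m : ℕ} (v : Fin n → ℝ) (b : Lam n (m + 1)) :
    starExt n (contr v (toExt b)) =
      (-1 : ℝ) ^ m • (ExteriorAlgebra.ι ℝ v * starExt n (toExt b)) := by
  rw [contr_eq_sum, ι_eq_sum, toExt_apply]
  simp only [map_sum, map_smul, Finset.sum_mul, Finset.smul_sum, Finset.mul_sum, smul_mul_assoc,
    mul_smul_comm, starExt_extBasis]
  rw [Finset.sum_comm]
  refine Finset.sum_congr rfl fun B _ => Finset.sum_congr rfl fun i _ => ?_
  rw [extGen_mul_extBasis]
  by_cases hi : i ∈ B.1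
  · have hB : B.1 = insert i (B.1.erase i) := (Finset.insert_erase hi).symm
    have hc : (B.1.erase i).card = m := by rw [Finset.card_erase_of_mem hi, B.2]; rfl
    have hi' := Finset.notMem_erase i B.1
    generalize B.1.erase i = C at hB hc hi'
    rw [hB, contr_single_extBasis_insert hi', map_smul, starExt_extBasis]
    have hC : Cᶜ = insert i (insert i C)ᶜ := by
      ext x
      by_cases hx : x = i <;> simp_all
    have h1 : i ∉ (insert i C)ᶜ := by simp
    rw [if_neg h1, hC]
    generalize hD : (insert i C)ᶜ = D at *
    have e1 := msign_mul_swap (R := {i}) (S := C) (by simpa using hi')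
    rw [Finset.insert_eq i D, Finset.insert_eq i C, msign_union_left _ (by simpa using hi'),
      msign_union_right _ (by simpa using h1)]
    rw [Finset.card_singleton, one_mul, hc] at e1
    rw [← e1]
    simp only [smul_smul]
    congr 1
    have e2 := msign_mul_self {i} D
    linear_combination (-(b B * msign {i} C * msign C {i} * msign C D) * v i) * e2
  · rw [contr_single_extBasis_of_notMem hi, if_pos (by simpa using hi)]
    simp

theorem hstar_iprod {n m l : ℕ} (h : m + 1 + l = n) (a : Lam n 1) (b : Lam n (m + 1)) :
    (hstar (iprod a b : Lam n m) : Lam n (l + 1)) =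
      (-1 : ℝ) ^ m • (wedge a (hstar b : Lam n l) : Lam n (l + 1)) := by
  apply toExt_injective
  rw [toExt_hstar (by omega), toExt_iprod rfl, starExt_contr, map_smul, toExt_wedge (by ring),
    toExt_one, toExt_hstar h]

theorem wedge_add_right {n k l m : ℕ} (h : m = k + l) (a : Lam n k) (b c : Lam n l) :
    (wedge a (b + c) : Lam n m) = wedge a b + wedge a c := by
  apply toExt_injective
  simp only [toExt_wedge h, map_add, mul_add]

theorem wedge_smul_right {n k l m : ℕ} (h : m = k + l) (a : Lam n k) (t : ℝ) (b : Lam n l) :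
    (wedge a (t • b) : Lam n m) = t • wedge a b := by
  apply toExt_injective
  simp only [toExt_wedge h, map_smul, mul_smul_comm]

theorem wedge_add_left {n k l m : ℕ} (h : m = k + l) (a b : Lam n k) (c : Lam n l) :
    (wedge (a + b) c : Lam n m) = wedge a c + wedge b c := by
  apply toExt_injective
  simp only [toExt_wedge h, map_add, add_mul]

theorem wedge_smul_left {n k l m : ℕ} (h : m = k + l) (t : ℝ) (a : Lam n k) (b : Lam n l) :
    (wedge (t • a) b : Lam n m) = t • wedge a b := by
  apply toExt_injective
  simp only [toExt_wedge h, map_smul, smul_mul_assoc]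

theorem toExt_mem_exteriorPower {n k : ℕ} (x : Lam n k) : toExt x ∈ ⋀[ℝ]^k (Fin n → ℝ) := by
  rw [toExt_apply]
  refine Submodule.sum_mem _ fun I _ => Submodule.smul_mem _ _ ?_
  obtain ⟨S, rfl⟩ := I
  rw [extBasis, ExteriorAlgebra.basis_apply]
  exact ExteriorAlgebra.ιMulti_range ℝ _ (Set.mem_range_self _)

theorem exists_toExt_eq_ιMulti {n : ℕ} (k : ℕ) (u : Fin k → Fin n → ℝ) :
    ∃ x : Lam n k, toExt x = ExteriorAlgebra.ιMulti ℝ k u := by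
  induction k with
  | zero => exact ⟨bform ∅, by rw [toExt_bform_empty]; simp⟩
  | succ k ih =>
    obtain ⟨x, hx⟩ := ih (Matrix.vecTail u)
    refine ⟨wedge (ofVec (u 0)) x, ?_⟩
    rw [toExt_wedge (by ring), toExt_one, vec_ofVec, hx, ExteriorAlgebra.ιMulti_succ_apply]

theorem exists_toExt_wedge_eq_ιMulti {n q : ℕ} (u : Fin (q + 1) → Fin n → ℝ) (i : Fin (q + 1)) :
    ∃ b : Lam n q, toExt (wedge (ofVec (u i)) b : Lam n (q + 1)) =
      ExteriorAlgebra.ιMulti ℝ (q + 1) u := by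
  obtain ⟨c, hc⟩ := exists_toExt_eq_ιMulti q (Matrix.vecTail (u ∘ Equiv.swap i 0))
  have h1 : toExt (wedge (ofVec (u i)) c : Lam n (q + 1)) =
      ExteriorAlgebra.ιMulti ℝ (q + 1) (u ∘ Equiv.swap i 0) := by
    rw [toExt_wedge (by ring), toExt_one, vec_ofVec, hc, ExteriorAlgebra.ιMulti_succ_apply]
    simp
  by_cases hi : i = 0
  · subst hi
    exact ⟨c, by simpa using h1⟩
  · refine ⟨-c, ?_⟩
    rw [AlternatingMap.map_swap _ _ hi] at h1
    rw [← neg_one_smul ℝ c, wedge_smul_right (by ring), map_smul, h1]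
    simp

theorem exists_linear_pow {n q : ℕ} {R : Type*} [Ring R] [Algebra ℝ R]
    (D : Lam n (q + 1) →ₗ[ℝ] R) (hcomm : ∀ x y, Commute (D x) (D y))
    (hD : ∀ (a : Lam n 1) (b c : Lam n q), D (wedge a b) * D (wedge a c) = 0) (N : ℕ) :
    ∃ L : ExtAlg n →ₗ[ℝ] R, ∀ x, D x ^ N = L (toExt x ^ N) := by
  obtain ⟨r, hr⟩ := LinearMap.exists_leftInverse_of_injective
    (toExt : Lam n (q + 1) →ₗ[ℝ] ExtAlg n) (LinearMap.ker_eq_bot.2 toExt_injective)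
  have hr' : ∀ x, r (toExt x) = x := fun x => LinearMap.congr_fun hr x
  suffices ∃ (m : ℕ) (L : ExtAlg n →ₗ[ℝ] R),
      (∀ (v : Fin m → Fin n → ℝ) (j : Fin m) (b : Lam n q),
        D (wedge (ofVec (v j)) b) * L (ExteriorAlgebra.ιMulti ℝ m v) = 0) ∧
      ∀ x, toExt x ^ N ∈ ⋀[ℝ]^m (Fin n → ℝ) ∧ D x ^ N = L (toExt x ^ N) by
    obtain ⟨m, L, -, hL⟩ := this
    exact ⟨L, fun x => (hL x).2⟩
  induction N with
  | zero =>
    refine ⟨0, (Algebra.linearMap ℝ R).comp ExteriorAlgebra.algebraMapInv.toLinearMap,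
      fun v j => j.elim0, fun x => ⟨?_, ?_⟩⟩
    · rw [pow_zero, ExteriorAlgebra.exteriorPower, pow_zero]; exact Submodule.one_le.1 le_rfl
    · simp
  | succ N ih =>
    obtain ⟨m, L, hL, hpow⟩ := ih
    have hblock : ∀ (u : Fin (q + 1) → Fin n → ℝ) (i : Fin (q + 1)), ∃ b : Lam n q,
        D (r (ExteriorAlgebra.ιMulti ℝ (q + 1) u)) = D (wedge (ofVec (u i)) b) := by
      intro u i
      obtain ⟨b, hb⟩ := exists_toExt_wedge_eq_ιMulti u i
      exact ⟨b, by rw [← hb, hr']⟩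
    let M : MultilinearMap ℝ (fun _ : Fin (q + 1 + m) => Fin n → ℝ) R :=
      ((LinearMap.mul' ℝ R).compMultilinearMap (MultilinearMap.domCoprod
        ((D ∘ₗ r).compAlternatingMap (ExteriorAlgebra.ιMulti ℝ (q + 1))).toMultilinearMap
        (L.compAlternatingMap (ExteriorAlgebra.ιMulti ℝ m)).toMultilinearMap)).domDomCongr
        finSumFinEquiv
    have hM : ∀ w, M w = D (r (ExteriorAlgebra.ιMulti ℝ (q + 1) fun i => w (Fin.castAdd m i))) *
        L (ExteriorAlgebra.ιMulti ℝ m fun j => w (Fin.natAdd (q + 1) j)) := fun w => rfl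
    have hcross : ∀ w (i : Fin (q + 1)) (j : Fin m),
        w (Fin.castAdd m i) = w (Fin.natAdd (q + 1) j) → M w = 0 := by
      intro w i j hw
      obtain ⟨b, hb⟩ := hblock (fun i => w (Fin.castAdd m i)) i
      rw [hM, hb, hw]
      exact hL (fun j => w (Fin.natAdd (q + 1) j)) j b
    let A : (Fin n → ℝ) [⋀^Fin (q + 1 + m)]→ₗ[ℝ] R :=
      { M with
        map_eq_zero_of_eq' := by
          intro w i j hw hij
          change M w = 0
          induction i using Fin.addCases with
          | left i =>
            induction j using Fin.addCases with
            | left j =>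
              rw [hM, AlternatingMap.map_eq_zero_of_eq (ExteriorAlgebra.ιMulti ℝ (q + 1))
                (fun i => w (Fin.castAdd m i)) hw (fun e => hij (by rw [e])),
                map_zero, map_zero, zero_mul]
            | right j => exact hcross w i j hw
          | right i =>
            induction j using Fin.addCases with
            | left j => exact hcross w j i hw.symm
            | right j =>
              rw [hM, AlternatingMap.map_eq_zero_of_eq (ExteriorAlgebra.ιMulti ℝ m)
                (fun j => w (Fin.natAdd (q + 1) j)) hw (fun e => hij (by rw [e])), map_zero, mul_zero] }
    let L' : ExtAlg n →ₗ[ℝ] R := ExteriorAlgebra.liftAlternating (Pi.single (q + 1 + m) A)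
    have hL' : ∀ w, L' (ExteriorAlgebra.ιMulti ℝ (q + 1 + m) w) = M w := by
      intro w
      simp only [L', ExteriorAlgebra.liftAlternating_apply_ιMulti, Pi.single_eq_same]
      rfl
    have hmul : ∀ y ∈ ⋀[ℝ]^(q + 1) (Fin n → ℝ), ∀ z ∈ ⋀[ℝ]^m (Fin n → ℝ),
        L' (y * z) = D (r y) * L z := by
      intro y hy z hz
      rw [← ExteriorAlgebra.ιMulti_span_fixedDegree] at hy hz
      induction hy, hz using Submodule.span_induction₂ with
      | mem_mem y z hy hz =>
        obtain ⟨u, rfl⟩ := hy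
        obtain ⟨v, rfl⟩ := hz
        rw [ExteriorAlgebra.ιMulti_mul_ιMulti, hL', hM]
        simp
      | zero_left => simp
      | zero_right => simp
      | add_left => simp_all [add_mul]
      | add_right => simp_all [mul_add]
      | smul_left => simp_all
      | smul_right => simp_all
    refine ⟨q + 1 + m, L', fun w j b => ?_, fun x => ⟨?_, ?_⟩⟩
    · rw [hL', hM, ← mul_assoc]
      induction j using Fin.addCases with
      | left i =>
        obtain ⟨c, hc⟩ := hblock (fun i => w (Fin.castAdd m i)) i
        rw [hc, hD, zero_mul]
      | right j =>
        rw [(hcomm _ _).eq, mul_assoc, hL (fun j => w (Fin.natAdd (q + 1) j)) j b, mul_zero]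
    · rw [pow_succ', ExteriorAlgebra.exteriorPower, pow_add]
      exact Submodule.mul_mem_mul (toExt_mem_exteriorPower x) (hpow x).1
    · rw [pow_succ', pow_succ', hmul _ (toExt_mem_exteriorPower x) _ (hpow x).1, hr', (hpow x).2]

/-- The functions on `Λ^{q+1}` which are affine along every direction `a ∧ b`. -/
def wedgeAffine (n q : ℕ) : Submodule ℝ (Lam n (q + 1) → ℝ) where
  carrier := {g | ∀ (ω : Lam n (q + 1)) (a : Lam n 1) (b : Lam n q) (t : ℝ),
    g (ω + t • wedge a b) = g ω + t * (g (ω + wedge a b) - g ω)}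
  zero_mem' := by simp
  add_mem' := by
    intro g g' hg hg' ω a b t
    rw [Pi.add_apply, hg, hg']
    simp only [Pi.add_apply]
    ring
  smul_mem' := by
    intro c g hg ω a b t
    rw [Pi.smul_apply, hg]
    simp only [Pi.smul_apply, smul_eq_mul]
    ring

/-- The difference operator `g ↦ g(· + x) - g`. -/
def wedgeDiff {n q : ℕ} (x : Lam n (q + 1)) : Module.End ℝ (wedgeAffine n q) where
  toFun g := ⟨fun ω => g.1 (ω + x) - g.1 ω, fun ω a b t => by
    have h1 := g.2 (ω + x) a b t
    have h2 := g.2 ω a b t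
    rw [add_right_comm] at h1
    simp only
    rw [h1, h2, add_right_comm ω x]
    ring⟩
  map_add' g g' := by
    ext ω
    simp only [Submodule.coe_add, Pi.add_apply]
    ring
  map_smul' c g := by
    ext ω
    simp only [Submodule.coe_smul, Pi.smul_apply, smul_eq_mul, RingHom.id_apply]
    ring

theorem wedgeDiff_apply {n q : ℕ} (x : Lam n (q + 1)) (g : wedgeAffine n q) (ω : Lam n (q + 1)) :
    (wedgeDiff x g).1 ω = g.1 (ω + x) - g.1 ω := rfl

theorem wedgeDiff_add {n q : ℕ} (x y : Lam n (q + 1)) :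
    wedgeDiff (x + y) = wedgeDiff x + wedgeDiff y + wedgeDiff x * wedgeDiff y := by
  ext g ω
  simp only [LinearMap.add_apply, Module.End.mul_apply, Submodule.coe_add, Pi.add_apply,
    wedgeDiff_apply, add_assoc]
  ring

theorem wedgeDiff_zero {n q : ℕ} : wedgeDiff (0 : Lam n (q + 1)) = 0 := by
  ext g ω
  simp [wedgeDiff_apply]

theorem wedgeDiff_commute {n q : ℕ} (x y : Lam n (q + 1)) :
    Commute (wedgeDiff x) (wedgeDiff y) := by
  ext g ω
  simp only [Module.End.mul_apply, wedgeDiff_apply, add_right_comm ω y]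
  ring

theorem wedgeDiff_smul_wedge {n q : ℕ} (t : ℝ) (a : Lam n 1) (b : Lam n q) :
    wedgeDiff (t • wedge a b : Lam n (q + 1)) = t • wedgeDiff (wedge a b) := by
  ext g ω
  simp only [LinearMap.smul_apply, Submodule.coe_smul, Pi.smul_apply, wedgeDiff_apply, smul_eq_mul]
  rw [g.2]
  ring

theorem wedgeDiff_wedge_mul_wedge {n q : ℕ} (a : Lam n 1) (b c : Lam n q) :
    (wedgeDiff (wedge a b) * wedgeDiff (wedge a c) : Module.End ℝ (wedgeAffine n q)) = 0 := by
  have h1 := wedgeDiff_smul_wedge 2 a (b + c)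
  rw [wedge_add_right (by ring), smul_add, wedgeDiff_add, wedgeDiff_add, wedgeDiff_smul_wedge,
    wedgeDiff_smul_wedge, smul_mul_smul_comm] at h1
  have h2 : (2 : ℝ) • (wedgeDiff (wedge a b) * wedgeDiff (wedge a c)
      : Module.End ℝ (wedgeAffine n q)) = 0 := by
    rw [← sub_eq_zero.2 h1]
    module
  simpa using h2

theorem wedgeDiff_wedge_add {n q : ℕ} (a : Lam n 1) (b c : Lam n q) :
    wedgeDiff (wedge a (b + c) : Lam n (q + 1)) =
      wedgeDiff (wedge a b) + wedgeDiff (wedge a c) := by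
  rw [wedge_add_right (by ring), wedgeDiff_add, wedgeDiff_wedge_mul_wedge, add_zero]

theorem ofVec_single_wedge_single {n q : ℕ} (i : Fin n) (J : Idx n q) (hi : i ∉ J.1) :
    (wedge (ofVec (Pi.single i 1)) (Pi.single J 1) : Lam n (q + 1)) =
      msign {i} J.1 • Pi.single ⟨insert i J.1, by rw [card_insert_of_notMem hi, J.2]⟩ 1 := by
  apply toExt_injective
  rw [toExt_wedge (by ring), toExt_one, vec_ofVec, toExt_single, map_smul, toExt_single, one_smul,
    one_smul]
  exact (extGen_mul_extBasis i J.1).trans (if_neg hi)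

theorem ofVec_single_wedge_single_of_mem {n q : ℕ} (i : Fin n) (J : Idx n q) (hi : i ∈ J.1) :
    (wedge (ofVec (Pi.single i 1)) (Pi.single J 1) : Lam n (q + 1)) = 0 := by
  apply toExt_injective
  rw [toExt_wedge (by ring), toExt_one, vec_ofVec, toExt_single, one_smul, map_zero]
  exact (extGen_mul_extBasis i J.1).trans (if_pos hi)

theorem exists_single_eq_wedge {n q : ℕ} (I : Idx n (q + 1)) {i : Fin n} (hi : i ∈ I.1) :
    ∃ b : Lam n q, (Pi.single I 1 : Lam n (q + 1)) = wedge (ofVec (Pi.single i 1)) b := by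
  have hc : (I.1.erase i).card = q := by rw [card_erase_of_mem hi, I.2]; rfl
  refine ⟨msign {i} (I.1.erase i) • Pi.single ⟨I.1.erase i, hc⟩ 1, ?_⟩
  rw [wedge_smul_right (by ring), ofVec_single_wedge_single _ _ (notMem_erase i _), smul_smul,
    msign_mul_self, one_smul]
  congr 2
  exact Subtype.ext (insert_erase hi).symm

theorem wedgeDiff_add_wedge_single {n q : ℕ} (a b : Lam n 1) (J : Idx n (q + 1)) :
    wedgeDiff (wedge (a + b) (Pi.single J 1) : Lam n (q + 1 + 1)) =
      wedgeDiff (wedge a (Pi.single J 1)) + wedgeDiff (wedge b (Pi.single J 1)) := by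
  obtain ⟨i, hi⟩ : J.1.Nonempty := card_pos.1 (by rw [J.2]; omega)
  obtain ⟨c, hc⟩ := exists_single_eq_wedge J hi
  have key : ∀ a : Lam n 1, (wedge a (Pi.single J 1) : Lam n (q + 1 + 1)) =
      wedge (ofVec (Pi.single i 1)) (-(wedge a c : Lam n (q + 1))) := by
    intro a
    apply toExt_injective
    rw [hc, toExt_wedge (by ring), toExt_wedge (by ring), toExt_wedge (by ring), map_neg,
      toExt_wedge (by ring), mul_neg, ← mul_assoc, ← mul_assoc, toExt_one, toExt_one, ← neg_mul]
    congr 1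
    exact eq_neg_of_add_eq_zero_left (ExteriorAlgebra.ι_add_mul_swap _ _)
  rw [key, key a, key b, wedge_add_left (by ring), neg_add, wedgeDiff_wedge_add]

/-- The linear map on forms extending the difference operators along the basis forms. -/
def wedgeDeriv (n q : ℕ) : Lam n (q + 1) →ₗ[ℝ] Module.End ℝ (wedgeAffine n q) :=
  Fintype.linearCombination ℝ fun I => wedgeDiff (Pi.single I 1)

theorem wedgeDeriv_single {n q : ℕ} (I : Idx n (q + 1)) (c : ℝ) :
    wedgeDeriv n q (Pi.single I c) = c • wedgeDiff (Pi.single I 1) := by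
  simp [wedgeDeriv]

theorem wedgeDeriv_wedge {n q : ℕ} (a : Lam n 1) (b : Lam n (q + 1)) :
    wedgeDeriv n (q + 1) (wedge a b) = wedgeDiff (wedge a b) := by
  have basis : ∀ (i : Fin n) (J : Idx n (q + 1)),
      wedgeDeriv n (q + 1) (wedge (ofVec (Pi.single i 1)) (Pi.single J 1)) =
        wedgeDiff (wedge (ofVec (Pi.single i 1)) (Pi.single J 1)) := by
    intro i J
    by_cases hi : i ∈ J.1
    · rw [ofVec_single_wedge_single_of_mem i J hi, map_zero, wedgeDiff_zero]
    · rw [ofVec_single_wedge_single i J hi, map_smul, wedgeDeriv_single, one_smul]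
      obtain ⟨c, hc⟩ := exists_single_eq_wedge ⟨insert i J.1, by
        rw [card_insert_of_notMem hi, J.2]⟩ (mem_insert_self i J.1)
      rw [hc, wedgeDiff_smul_wedge]
  have left : ∀ (a : Lam n 1) (J : Idx n (q + 1)),
      wedgeDeriv n (q + 1) (wedge a (Pi.single J 1)) = wedgeDiff (wedge a (Pi.single J 1)) := by
    intro a J
    let L : Lam n 1 →ₗ[ℝ] Module.End ℝ (wedgeAffine n (q + 1)) :=
      { toFun := fun a => wedgeDiff (wedge a (Pi.single J 1))
        map_add' := fun a b => wedgeDiff_add_wedge_single a b J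
        map_smul' := fun t a => by
          rw [wedge_smul_left (by ring), wedgeDiff_smul_wedge]; rfl }
    let L' : Lam n 1 →ₗ[ℝ] Module.End ℝ (wedgeAffine n (q + 1)) :=
      { toFun := fun a => wedgeDeriv n (q + 1) (wedge a (Pi.single J 1))
        map_add' := fun a b => by rw [wedge_add_left (by ring), map_add]
        map_smul' := fun t a => by rw [wedge_smul_left (by ring), map_smul]; rfl }
    suffices L' = L from LinearMap.congr_fun this a
    refine (Pi.basisFun ℝ (Idx n 1)).ext fun I => ?_
    obtain ⟨i, rfl⟩ := (idxOneEquiv n).surjective I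
    have : (Pi.single (idxOneEquiv n i) 1 : Lam n 1) = ofVec (Pi.single i 1) := by
      ext K
      obtain ⟨j, rfl⟩ := (idxOneEquiv n).surjective K
      rw [ofVec, idxOneEquiv_coe, sum_singleton]
      simp [Pi.single_apply]
    rw [Pi.basisFun_apply, this]
    exact basis i J
  let L : Lam n (q + 1) →ₗ[ℝ] Module.End ℝ (wedgeAffine n (q + 1)) :=
    { toFun := fun b => wedgeDiff (wedge a b)
      map_add' := fun b c => wedgeDiff_wedge_add a b c
      map_smul' := fun t b => by
        rw [wedge_smul_right (by ring), wedgeDiff_smul_wedge]; rfl }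
  let L' : Lam n (q + 1) →ₗ[ℝ] Module.End ℝ (wedgeAffine n (q + 1)) :=
    { toFun := fun b => wedgeDeriv n (q + 1) (wedge a b)
      map_add' := fun b c => by rw [wedge_add_right (by ring), map_add]
      map_smul' := fun t b => by rw [wedge_smul_right (by ring), map_smul]; rfl }
  suffices L' = L from LinearMap.congr_fun this b
  refine (Pi.basisFun ℝ (Idx n (q + 1))).ext fun J => ?_
  rw [Pi.basisFun_apply]
  exact left a J

theorem wedgeDeriv_commute {n q : ℕ} (x y : Lam n (q + 1)) :
    Commute (wedgeDeriv n q x) (wedgeDeriv n q y) := by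
  simp only [wedgeDeriv, Fintype.linearCombination_apply]
  exact Commute.sum_left _ _ _ fun I _ => Commute.sum_right _ _ _ fun J _ =>
    ((wedgeDiff_commute _ _).smul_left _).smul_right _

theorem wedgeDiff_single_mul_self {n q : ℕ} (I : Idx n (q + 1)) :
    (wedgeDiff (Pi.single I 1) * wedgeDiff (Pi.single I 1) :
      Module.End ℝ (wedgeAffine n q)) = 0 := by
  obtain ⟨i, hi⟩ : I.1.Nonempty := card_pos.1 (by rw [I.2]; omega)
  obtain ⟨c, hc⟩ := exists_single_eq_wedge I hi
  rw [hc, wedgeDiff_wedge_mul_wedge]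

theorem wedgeDiff_single {n q : ℕ} (I : Idx n (q + 1)) (t : ℝ) :
    wedgeDiff (Pi.single I t) = t • wedgeDiff (Pi.single I 1) := by
  obtain ⟨i, hi⟩ : I.1.Nonempty := card_pos.1 (by rw [I.2]; omega)
  obtain ⟨c, hc⟩ := exists_single_eq_wedge I hi
  have : (Pi.single I t : Lam n (q + 1)) = t • Pi.single I 1 := by
    rw [← Pi.single_smul, smul_eq_mul, mul_one]
  rw [this, hc, wedgeDiff_smul_wedge]

theorem one_add_wedgeDiff_eq_exp {n q : ℕ} (x : Lam n (q + 1)) :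
    IsNilpotent (wedgeDeriv n q x) ∧
      1 + wedgeDiff x = IsNilpotent.exp (wedgeDeriv n q x) := by
  suffices ∀ s : Finset (Idx n (q + 1)),
      IsNilpotent (wedgeDeriv n q (∑ I ∈ s, Pi.single I (x I))) ∧
      1 + wedgeDiff (∑ I ∈ s, Pi.single I (x I)) =
        IsNilpotent.exp (wedgeDeriv n q (∑ I ∈ s, Pi.single I (x I))) by
    simpa only [Finset.univ_sum_single] using this univ
  intro s
  induction s using Finset.induction_on with
  | empty => simp [wedgeDiff_zero, IsNilpotent.exp_zero]
  | insert I s hI ih =>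
    have h0 : wedgeDeriv n q (Pi.single I (x I)) ^ 2 = 0 := by
      rw [pow_two, wedgeDeriv_single, smul_mul_smul_comm, wedgeDiff_single_mul_self, smul_zero]
    have hnil : IsNilpotent (wedgeDeriv n q (Pi.single I (x I))) := ⟨2, h0⟩
    rw [sum_insert hI, map_add]
    refine ⟨(wedgeDeriv_commute _ _).isNilpotent_add hnil ih.1, ?_⟩
    rw [IsNilpotent.exp_add_of_commute (wedgeDeriv_commute _ _) hnil ih.1, ← ih.2,
      IsNilpotent.exp_eq_sum h0, wedgeDiff_add]
    simp only [sum_range_succ, range_zero, sum_empty, wedgeDeriv_single, ← wedgeDiff_single]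
    simp
    noncomm_ring

theorem exists_eq_sum_lpow {n p : ℕ} (hp : 1 ≤ p) {g : Lam n (p + 1) → ℝ}
    (hg : g ∈ wedgeAffine n p) :
    ∃ l : (N : Fin (n / (p + 1))) → Lam n ((p + 1) * (N.1 + 1)) →ₗ[ℝ] ℝ,
      ∀ x, g x = g 0 + ∑ N, l N (lpow x (N.1 + 1)) := by
  obtain ⟨q, rfl⟩ := Nat.exists_eq_add_of_le' hp
  have hmul : ∀ (a : Lam n 1) (b c : Lam n (q + 1)),
      wedgeDeriv n (q + 1) (wedge a b) * wedgeDeriv n (q + 1) (wedge a c) = 0 := fun a b c => by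
    rw [wedgeDeriv_wedge, wedgeDeriv_wedge, wedgeDiff_wedge_mul_wedge]
  choose L hL using exists_linear_pow (R := Module.End ℝ (wedgeAffine n (q + 1)))
    (wedgeDeriv n (q + 1)) wedgeDeriv_commute hmul
  have hpow : ∀ x, wedgeDeriv n (q + 1) x ^ (n / (q + 1 + 1) + 1) = 0 := by
    intro x
    rw [hL, ← toExt_lpow]
    have : lpow x (n / (q + 1 + 1) + 1) = 0 := by
      ext I
      have h1 := card_le_univ I.1
      rw [I.2, Fintype.card_fin] at h1
      exact absurd h1 (Nat.lt_mul_div_succ n (by omega)).not_ge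
    rw [this, map_zero, map_zero]
  let ev : Module.End ℝ (wedgeAffine n (q + 1)) →ₗ[ℝ] ℝ :=
    { toFun := fun T => (T ⟨g, hg⟩).1 0
      map_add' := fun _ _ => rfl
      map_smul' := fun _ _ => rfl }
  refine ⟨fun N => (((N.1 + 1).factorial : ℝ)⁻¹) • (ev ∘ₗ L (N.1 + 1) ∘ₗ toExt), fun x => ?_⟩
  have h1 : g x = ev (1 + wedgeDiff x) := by
    change g x = g 0 + (g (0 + x) - g 0)
    rw [zero_add]; ring
  rw [h1, (one_add_wedgeDiff_eq_exp x).2, IsNilpotent.exp_eq_sum (hpow x), sum_range_succ',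
    map_add, map_sum, add_comm (g 0), Fin.sum_univ_eq_sum_range (fun N =>
      ((((N + 1).factorial : ℝ)⁻¹) • (ev ∘ₗ L (N + 1) ∘ₗ toExt)) (lpow x (N + 1)))]
  congr 1
  · refine sum_congr rfl fun N _ => ?_
    simp only [LinearMap.smul_apply, LinearMap.comp_apply, toExt_lpow, ← hL]
    rw [← Rat.cast_smul_eq_qsmul ℝ, map_smul]
    simp
  · simp [ev]

theorem hstar_add_smul {n k m : ℕ} (h : k + m = n) (x y : Lam n k) (t : ℝ) :
    (hstar (x + t • y) : Lam n m) = hstar x + t • hstar y := by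
  apply toExt_injective
  simp only [toExt_hstar h, map_add, map_smul]

theorem ExtIntPolyconvex.extIntOneConvex {n k : ℕ} (hk : 1 ≤ k) (hkn : k ≤ n - 1)
    {f : Lam n (k + 1) → Lam n (k - 1) → ℝ} (hf : ExtIntPolyconvex f) : ExtIntOneConvex f := by
  obtain ⟨F, hF, hfF⟩ := hf
  obtain ⟨q, rfl⟩ := Nat.exists_eq_add_of_le' hk
  intro ξ (η : Lam n q) a b
  let P : ℝ → ((s : Fin (n / (q + 1 + 1))) → Lam n ((q + 1 + 1) * (s.1 + 1))) ×
      ((r : Fin (n / (n - (q + 1) + 1))) → Lam n ((n - (q + 1) + 1) * (r.1 + 1))) := fun t =>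
    ⟨fun s => lpow (ξ + t • (wedge a b : Lam n (q + 1 + 1))) (s.1 + 1), fun r =>
      lpow (hstar (η + t • (iprod a b : Lam n q)) : Lam n (n - (q + 1) + 1)) (r.1 + 1)⟩
  have hstar_line : ∀ t : ℝ, (hstar (η + t • (iprod a b : Lam n q)) : Lam n (n - (q + 1) + 1)) =
      hstar η + t • wedge a ((-1 : ℝ) ^ q • hstar b : Lam n (n - (q + 1))) := by
    intro t
    rw [hstar_add_smul (by omega), hstar_iprod (by omega), wedge_smul_right (by ring)]
  have hP : ∀ t, P t = AffineMap.lineMap (P 0) (P 1) t := by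
    intro t
    rw [AffineMap.lineMap_apply_module']
    refine Prod.ext (funext fun s => ?_) (funext fun r => ?_)
    · simpa [P] using lpow_add_smul_wedge (by ring) ξ a b (s.1 + 1) t
    · simp only [P, Prod.snd_add, Prod.smul_snd, Prod.snd_sub, Pi.add_apply, Pi.smul_apply,
        Pi.sub_apply, hstar_line]
      simpa using lpow_add_smul_wedge (by ring) (hstar η) a
        ((-1 : ℝ) ^ q • hstar b : Lam n (n - (q + 1))) (r.1 + 1) t
  have h1 := hF.comp_affineMap (AffineMap.lineMap (P 0) (P 1) : ℝ →ᵃ[ℝ] _)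
  have h2 : (fun t : ℝ => f (ξ + t • (wedge a b : Lam n (q + 1 + 1)))
      (η + t • (iprod a b : Lam n q))) = F ∘ AffineMap.lineMap (P 0) (P 1) := by
    funext t
    rw [Function.comp_apply, ← hP]
    exact hfF _ _
  exact h2 ▸ h1

theorem exists_wedge_eq_and_iprod_eq {n q : ℕ} (a : Lam n 1) (β γ : Lam n (q + 1)) :
    ∃ b : Lam n (q + 1), (wedge a b : Lam n (q + 1 + 1)) = wedge a β ∧
      (iprod a b : Lam n q) = iprod a γ := by
  by_cases hs : ∑ i, vec a i * vec a i = 0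
  · have hv : vec a = 0 := by
      funext i
      exact mul_self_eq_zero.1
        ((sum_eq_zero_iff_of_nonneg fun i _ => mul_self_nonneg (vec a i)).1 hs i (mem_univ i))
    refine ⟨γ, toExt_injective ?_, rfl⟩
    rw [toExt_wedge (by ring), toExt_wedge (by ring), toExt_one, hv, map_zero, zero_mul, zero_mul]
  · refine ⟨(∑ i, vec a i * vec a i)⁻¹ • (iprod a (wedge a β : Lam n (q + 1 + 1)) +
      wedge a (iprod a γ : Lam n q)), toExt_injective ?_, toExt_injective ?_⟩
    · rw [toExt_wedge (by ring), map_smul, map_add, toExt_iprod rfl, toExt_wedge (by ring),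
        toExt_wedge (by ring), toExt_one, contr_ι_mul, mul_smul_comm, mul_add, mul_sub,
        ← mul_assoc, ← mul_assoc, ExteriorAlgebra.ι_sq_zero, zero_mul, zero_mul, sub_zero,
        add_zero, mul_smul_comm, inv_smul_smul₀ hs]
    · rw [toExt_iprod rfl, toExt_iprod rfl, map_smul, map_add, toExt_iprod rfl, map_smul, map_add,
        contr_contr, toExt_wedge (by ring), toExt_iprod rfl, toExt_one, contr_ι_mul, contr_contr, mul_zero, sub_zero, zero_add, inv_smul_smul₀ hs]

theorem iprod_smul_right {n k m : ℕ} (h : k = m + 1) (a : Lam n 1) (t : ℝ) (b : Lam n k) :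
    (iprod a (t • b) : Lam n m) = t • iprod a b := by
  apply toExt_injective
  simp only [toExt_iprod h, map_smul]

theorem exists_single_eq_iprod {n q : ℕ} (J : Idx n q) {i : Fin n} (hi : i ∉ J.1) :
    ∃ b : Lam n (q + 1), (Pi.single J 1 : Lam n q) = iprod (ofVec (Pi.single i 1)) b := by
  have hc : (insert i J.1).card = q + 1 := by rw [card_insert_of_notMem hi, J.2]
  refine ⟨msign {i} J.1 • Pi.single ⟨insert i J.1, hc⟩ 1, toExt_injective ?_⟩
  rw [toExt_iprod rfl, vec_ofVec, map_smul, map_smul, toExt_single, toExt_single, one_smul,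
    one_smul, contr_single_extBasis_insert hi, smul_smul, msign_mul_self, one_smul]

theorem apply_eq_apply_zero_of_add_single {ι : Type*} [Fintype ι] [DecidableEq ι]
    {G : (ι → ℝ) → ℝ} (h : ∀ x i s, G (x + Pi.single i s) = G x) (x : ι → ℝ) : G x = G 0 := by
  suffices ∀ s : Finset ι, G (∑ i ∈ s, Pi.single i (x i)) = G 0 by
    simpa only [Finset.univ_sum_single] using this univ
  intro s
  induction s using Finset.induction_on with
  | empty => rw [sum_empty]
  | insert i s hi ih => rw [sum_insert hi, add_comm, h, ih]

/-- `f` is affine along every direction `(a ∧ b, a ⌟ b)`. -/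
def WedgeIprodAffine {n q : ℕ} (f : Lam n (q + 1 + 1) → Lam n q → ℝ) : Prop :=
  ∀ (ξ : Lam n (q + 1 + 1)) (η : Lam n q) (a : Lam n 1) (b : Lam n (q + 1)) (t : ℝ),
    f (ξ + t • wedge a b) (η + t • iprod a b) =
      f ξ η + t * (f (ξ + wedge a b) (η + iprod a b) - f ξ η)

theorem eq_of_convexOn_of_convexOn_neg {φ : ℝ → ℝ} (h : ConvexOn ℝ Set.univ φ)
    (h' : ConvexOn ℝ Set.univ fun t => -φ t) (t : ℝ) : φ t = φ 0 + t * (φ 1 - φ 0) := by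
  have key : ∀ x y c : ℝ, 0 ≤ c → c ≤ 1 → φ (x + c * (y - x)) = φ x + c * (φ y - φ x) := by
    intro x y c h0 h1
    have e1 := h.2 (Set.mem_univ x) (Set.mem_univ y) (sub_nonneg.2 h1) h0 (by ring)
    have e2 := h'.2 (Set.mem_univ x) (Set.mem_univ y) (sub_nonneg.2 h1) h0 (by ring)
    simp only [smul_eq_mul] at e1 e2
    rw [show (1 - c) * x + c * y = x + c * (y - x) by ring] at e1 e2
    linarith
  rcases le_or_gt t 0 with h0 | h0
  · have h1 : 0 < 1 - t := by linarith
    have h2 := key t 1 (-t / (1 - t)) (div_nonneg (by linarith) h1.le) ((div_le_one h1).2 (by linarith))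
    rw [show t + -t / (1 - t) * (1 - t) = 0 by field_simp; ring] at h2
    rw [h2]
    field_simp
    ring
  · rcases le_or_gt t 1 with h1 | h1
    · simpa using key 0 1 t h0.le h1
    · have h2 := key 0 t t⁻¹ (by positivity) (inv_le_one_of_one_le₀ h1.le)
      rw [sub_zero, zero_add, inv_mul_cancel₀ h0.ne'] at h2
      rw [h2]
      field_simp
      ring

theorem ExtIntOneAffine.wedgeIprodAffine {n q : ℕ} {f : Lam n (q + 1 + 1) → Lam n q → ℝ}
    (hf : ExtIntOneAffine (k := q + 1) f) : WedgeIprodAffine f := by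
  intro ξ η a b t
  simpa using eq_of_convexOn_of_convexOn_neg (hf.1 ξ η a b) (hf.2 ξ η a b) t

namespace WedgeIprodAffine

variable {n q : ℕ} {f : Lam n (q + 1 + 1) → Lam n q → ℝ}

theorem apply_add_smul (hf : WedgeIprodAffine f) (ξ : Lam n (q + 1 + 1)) (η : Lam n q)
    (a : Lam n 1) (β γ : Lam n (q + 1)) (t : ℝ) : f (ξ + t • wedge a β) (η + t • iprod a γ) =
      f ξ η + t * (f (ξ + wedge a β) (η + iprod a γ) - f ξ η) := by
  obtain ⟨b, h1, h2⟩ := exists_wedge_eq_and_iprod_eq a β γ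
  rw [← h1, ← h2, hf]

theorem apply_add_add (hf : WedgeIprodAffine f) (ξ : Lam n (q + 1 + 1)) (η : Lam n q)
    (a : Lam n 1) (β γ : Lam n (q + 1)) :
    f (ξ + wedge a β) (η + iprod a γ) + f ξ η =
      f (ξ + wedge a β) η + f ξ (η + iprod a γ) := by
  have h1 := hf.apply_add_smul ξ η a β γ 2⁻¹
  have h2 := hf.apply_add_smul (ξ + wedge a β) η a (-(1 : ℝ) • β) γ 2⁻¹
  rw [wedge_smul_right (by ring)] at h2
  have e1 : ξ + wedge a β + (2⁻¹ : ℝ) • -(1 : ℝ) • (wedge a β : Lam n (q + 1 + 1)) =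
      ξ + (2⁻¹ : ℝ) • wedge a β := by module
  have e2 : ξ + wedge a β + -(1 : ℝ) • (wedge a β : Lam n (q + 1 + 1)) = ξ := by module
  rw [e1, e2] at h2
  linarith

theorem apply_add_single_add_single (hf : WedgeIprodAffine f) (ξ : Lam n (q + 1 + 1))
    (η : Lam n q) (I : Idx n (q + 1 + 1)) (J : Idx n q) (s t : ℝ) :
    f (ξ + Pi.single I s) (η + Pi.single J t) + f ξ η =
      f (ξ + Pi.single I s) η + f ξ (η + Pi.single J t) := by
  obtain ⟨i, hi, hiJ⟩ : ∃ i ∈ I.1, i ∉ J.1 :=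
    exists_mem_notMem_of_card_lt_card (by rw [I.2, J.2]; omega)
  obtain ⟨β, hβ⟩ := exists_single_eq_wedge I hi
  obtain ⟨γ, hγ⟩ := exists_single_eq_iprod J hiJ
  have h1 : (Pi.single I s : Lam n (q + 1 + 1)) = wedge (ofVec (Pi.single i 1)) (s • β) := by
    rw [wedge_smul_right (by ring), ← hβ, ← Pi.single_smul, smul_eq_mul, mul_one]
  have h2 : (Pi.single J t : Lam n q) = iprod (ofVec (Pi.single i 1)) (t • γ) := by
    rw [iprod_smul_right rfl, ← hγ, ← Pi.single_smul, smul_eq_mul, mul_one]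
  rw [h1, h2, hf.apply_add_add]

theorem apply_eq_add (hf : WedgeIprodAffine f) (ξ : Lam n (q + 1 + 1)) (η : Lam n q) :
    f ξ η = f ξ 0 + f 0 η - f 0 0 := by
  have h1 : ∀ J t η ξ, f ξ (η + Pi.single J t) - f ξ η = f 0 (η + Pi.single J t) - f 0 η := by
    intro J t η
    refine apply_eq_apply_zero_of_add_single (G := fun ξ => f ξ (η + Pi.single J t) - f ξ η) ?_
    intro x I s
    linarith [hf.apply_add_single_add_single x η I J s t]
  have h2 := apply_eq_apply_zero_of_add_single (G := fun η => f ξ η - f 0 η)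
    (fun η J t => by linarith [h1 J t η ξ]) η
  linarith

theorem left_mem_wedgeAffine (hf : WedgeIprodAffine f) :
    (fun ξ => f ξ 0) ∈ wedgeAffine n (q + 1) := by
  intro ω a b t
  have h1 := hf.apply_add_smul ω 0 a b 0 t
  have h2 : (iprod a (0 : Lam n (q + 1)) : Lam n q) = 0 := by
    simpa using iprod_smul_right (m := q) rfl a 0 0
  simpa [h2] using h1

theorem right_mem_wedgeAffine (hf : WedgeIprodAffine f) {l : ℕ} (h : q + 1 + l = n) :
    (fun ζ : Lam n (l + 1) => f 0 ((-1 : ℝ) ^ (q * (l + 1)) • hstar ζ)) ∈ wedgeAffine n l := by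
  intro ω a c t
  have h0 : (wedge a (0 : Lam n (q + 1)) : Lam n (q + 1 + 1)) = 0 := by
    simpa using wedge_smul_right (m := q + 1 + 1) (by ring) a 0 0
  let b : Lam n (q + 1) := (-1 : ℝ) ^ q • (-1 : ℝ) ^ (l * (q + 1)) • hstar c
  have hb : (hstar b : Lam n l) = (-1 : ℝ) ^ q • c := by
    apply toExt_injective
    have hc := congrArg toExt (hstar_hstar (show l + (q + 1) = n by omega) c)
    rw [toExt_hstar (by omega)] at hc
    rw [toExt_hstar (by omega), map_smul, map_smul, map_smul, map_smul, hc, map_smul,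
      smul_smul ((-1 : ℝ) ^ (l * (q + 1))), ← mul_pow]
    simp
  have hw : (hstar (iprod a b : Lam n q) : Lam n (l + 1)) = wedge a c := by
    rw [hstar_iprod h, hb, wedge_smul_right (by ring), smul_smul, ← mul_pow]
    simp
  have hw' : (-1 : ℝ) ^ (q * (l + 1)) • (hstar (wedge a c : Lam n (l + 1)) : Lam n q) =
      iprod a b := by
    rw [← hw, hstar_hstar (by omega), smul_smul, ← mul_pow]
    simp
  have key : ∀ t : ℝ, (-1 : ℝ) ^ (q * (l + 1)) •
      (hstar (ω + t • (wedge a c : Lam n (l + 1))) : Lam n q) =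
        (-1 : ℝ) ^ (q * (l + 1)) • hstar ω + t • iprod a b := by
    intro t
    rw [hstar_add_smul (by omega), smul_add, smul_comm, hw']
  have key1 := key 1
  rw [one_smul, one_smul] at key1
  have h1 := hf.apply_add_smul 0 ((-1 : ℝ) ^ (q * (l + 1)) • hstar ω) a 0 b t
  rw [h0, smul_zero, add_zero, ← key, ← key1] at h1
  exact h1

end WedgeIprodAffine

theorem ExtIntOneAffine.extIntPolyconvex {n k : ℕ} (hk : 1 ≤ k) (hkn : k ≤ n - 1)
    {f : Lam n (k + 1) → Lam n (k - 1) → ℝ} (hf : ExtIntOneAffine f) : ExtIntPolyconvex f := by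
  obtain ⟨q, rfl⟩ := Nat.exists_eq_add_of_le' hk
  have hf' : WedgeIprodAffine (q := q) f := hf.wedgeIprodAffine
  obtain ⟨l₁, h₁⟩ := exists_eq_sum_lpow (by omega) hf'.left_mem_wedgeAffine
  obtain ⟨l₂, h₂⟩ := exists_eq_sum_lpow (p := n - (q + 1)) (by omega)
    (hf'.right_mem_wedgeAffine (by omega))
  let Φ : (((s : Fin (n / (q + 1 + 1))) → Lam n ((q + 1 + 1) * (s.1 + 1))) ×
      ((r : Fin (n / (n - (q + 1) + 1))) → Lam n ((n - (q + 1) + 1) * (r.1 + 1)))) →ₗ[ℝ] ℝ :=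
    (∑ s, l₁ s ∘ₗ LinearMap.proj s) ∘ₗ LinearMap.fst ℝ _ _ +
      (∑ r, l₂ r ∘ₗ LinearMap.proj r) ∘ₗ LinearMap.snd ℝ _ _
  refine ⟨fun P => Φ P + f 0 0, (Φ.convexOn convex_univ).add_const _, fun ξ (η : Lam n q) => ?_⟩
  have h₃ := h₂ (hstar η)
  rw [hstar_hstar (by omega), smul_smul, ← mul_pow] at h₃
  have h0 : (hstar (0 : Lam n (n - (q + 1) + 1)) : Lam n q) = 0 := by
    apply toExt_injective
    rw [toExt_hstar (by omega), map_zero, map_zero, map_zero]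
  have h₄ : f 0 η = f 0 0 + ∑ r, l₂ r (lpow (hstar η) (r.1 + 1)) := by
    simpa [h0] using h₃
  have h₅ : f ξ 0 = f 0 0 + ∑ s, l₁ s (lpow ξ (s.1 + 1)) := h₁ ξ
  have h₆ : f ξ η = f ξ 0 + f 0 η - f 0 0 := hf'.apply_eq_add ξ η
  rw [h₆, h₅, h₄]
  simp only [Φ, LinearMap.add_apply, LinearMap.comp_apply, LinearMap.fst_apply,
    LinearMap.snd_apply, LinearMap.sum_apply, LinearMap.proj_apply]
  ring

/-- **Theorem.** Let `1 ≤ k ≤ n-1` and `f : Λ^{k+1} × Λ^{k-1} → ℝ`.  Then `f` is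
ext-int. polyaffine iff `f` is ext-int. one affine. -/
theorem stmt1 {n k : ℕ} (hk : 1 ≤ k) (hkn : k ≤ n - 1)
    (f : Lam n (k+1) → Lam n (k-1) → ℝ) :
    ExtIntPolyaffine f ↔ ExtIntOneAffine f := by
  exact ⟨fun h => ⟨h.1.extIntOneConvex hk hkn, h.2.extIntOneConvex hk hkn⟩, fun h =>
    ⟨h.extIntPolyconvex hk hkn,
      ExtIntOneAffine.extIntPolyconvex hk hkn ⟨h.2, by simpa only [neg_neg] using h.1⟩⟩⟩
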